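/- arXiv:2004.14741 — 3 statements merged into one kernel-verified Lean document; each statement's English description precedes it below -/
import Mathlib

section
/- For every n ≥ 2, k ≥ 2, and δ ∈ (0,1), the worst-case Lipschitz constant of δ-perturbed anonymous games satisfies λ(n,k,δ) = (1-δ)·max_{a ∈ [k]^{n-2}} d_TV(e_1 + N(a^δ), e_2 + N(a^δ)). -/
open Finset

/-- `perturbW k δ a j` is the probability that the `δ`-perturbation of the pure
action `a ∈ [k]` plays the action `j`: with probability `1-δ` play `a`, with
probability `δ` play uniformly in `[k]`. -/
noncomputable def perturbW (k : ℕ) (δ : ℝ) (a j : Fin k) : ℝ :=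
  (1 - δ) * (if j = a then 1 else 0) + δ / k

/-- Probability that the (independent) `δ`-perturbation of the pure profile `a`
realises as the pure profile `b`. -/
noncomputable def profW (n k : ℕ) (δ : ℝ) (a b : Fin n → Fin k) : ℝ :=
  ∏ i, perturbW k δ (a i) (b i)

/-- A game: payoffs lie in `[0,1]`. -/
def IsGame (n k : ℕ) (g : (Fin n → Fin k) → Fin n → ℝ) : Prop :=
  ∀ a i, g a i ∈ Set.Icc (0 : ℝ) 1

/-- The number of players taking action `j` in the profile `a`. -/
def actCount (n k : ℕ) (a : Fin n → Fin k) (j : Fin k) : ℕ :=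
  (Finset.univ.filter fun i => a i = j).card

/-- A game is anonymous if each player's payoff depends only on his own action and
on the number of players taking each action. -/
def IsAnonymous (n k : ℕ) (g : (Fin n → Fin k) → Fin n → ℝ) : Prop :=
  ∀ (a b : Fin n → Fin k) (i : Fin n), a i = b i →
    (∀ j, actCount n k a j = actCount n k b j) → g a i = g b i

/-- The `δ`-perturbed game `g^δ`. -/
noncomputable def perturbGame (n k : ℕ) (δ : ℝ) (g : (Fin n → Fin k) → Fin n → ℝ) :
    (Fin n → Fin k) → Fin n → ℝ :=
  fun a i => ∑ b : Fin n → Fin k, profW n k δ a b * g b i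

/-- The Lipschitz constant of a game: the largest change of some player's payoff
when a single opponent changes his action. -/
noncomputable def lipC (n k : ℕ) (g : (Fin n → Fin k) → Fin n → ℝ) : ℝ :=
  sSup {x | ∃ (i : Fin n) (a b : Fin n → Fin k), a i = b i ∧
    (Finset.univ.filter fun j => a j ≠ b j).card = 1 ∧ x = |g a i - g b i|}

/-- The worst-case Lipschitz constant of `δ`-perturbed `n`-player `k`-action
anonymous games. -/
noncomputable def lam (n k : ℕ) (δ : ℝ) : ℝ :=
  sSup {x | ∃ g : (Fin n → Fin k) → Fin n → ℝ,
    IsGame n k g ∧ IsAnonymous n k g ∧ x = lipC n k (perturbGame n k δ g)}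
/-- `walk r m z` is the probability that the lazy symmetric random walk on `ℤ` with
rate `r` (i.i.d. increments: `0` w.p. `1-r`, `±1` w.p. `r/2` each), started at `0`,
is at `z` after `m` steps; i.e. `P(S_m^r = z)`. -/
noncomputable def walk (r : ℝ) : ℕ → ℤ → ℝ
  | 0, z => if z = 0 then 1 else 0
  | m + 1, z => (1 - r) * walk r m z + r / 2 * walk r m (z - 1) + r / 2 * walk r m (z + 1)
/-- The `j`-th standard basis vector of `ℤ^k`. -/
def basisVec (k : ℕ) (j : Fin k) : Fin k → ℤ := fun j' => if j' = j then 1 else 0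

/-- The vector counting how many players take each action in the profile `a`,
viewed in `ℤ^k`. -/
def countVec (n k : ℕ) (a : Fin n → Fin k) : Fin k → ℤ :=
  fun j => ((Finset.univ.filter fun i => a i = j).card : ℤ)

/-- `shiftCountDist n k δ a v x` is the probability `P(v + N(a^δ) = x)`, i.e. the
distribution of the action-count vector of the `δ`-perturbation of the profile `a`,
shifted by the vector `v ∈ ℤ^k`. -/
noncomputable def shiftCountDist (n k : ℕ) (δ : ℝ) (a : Fin n → Fin k)
    (v : Fin k → ℤ) (x : Fin k → ℤ) : ℝ :=
  ∑ b : Fin n → Fin k, profW n k δ a b * (if v + countVec n k b = x then 1 else 0)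

/-- The total variation distance between two distributions on `α`, given by their
probability mass functions: the supremum over events `A ⊆ α` of the discrepancy. -/
noncomputable def dTV {α : Type*} (P Q : α → ℝ) : ℝ :=
  sSup {x | ∃ A : Set α, x = |(∑' a : A, P a) - (∑' a : A, Q a)|}

/-- The expectation of `F` under the `δ`-perturbation of the pure profile `a`. -/
noncomputable def perturbExp {m k : ℕ} (δ : ℝ) (a : Fin m → Fin k)
    (F : (Fin m → Fin k) → ℝ) : ℝ :=
  ∑ b, profW m k δ a b * F b

section Perturbation

variable {m k : ℕ} {δ : ℝ}

lemma perturbW_nonneg (hδ : δ ∈ Set.Ioo (0 : ℝ) 1) (a j : Fin k) : 0 ≤ perturbW k δ a j := by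
  have h0 : 0 < δ := hδ.1
  have h1 : 0 ≤ 1 - δ := by linarith [hδ.2]
  unfold perturbW
  split_ifs <;> positivity

lemma sum_perturbW (a : Fin k) : ∑ j, perturbW k δ a j = 1 := by
  have hk : (k : ℝ) ≠ 0 := by
    have := a.pos
    positivity
  simp only [perturbW, sum_add_distrib, ← mul_sum, sum_ite_eq', mem_univ, if_true, sum_const,
    card_univ, Fintype.card_fin, nsmul_eq_mul]
  field_simp
  ring

lemma sum_perturbW_sub (x y : Fin k) (H : Fin k → ℝ) :
    ∑ j, perturbW k δ x j * H j - ∑ j, perturbW k δ y j * H j = (1 - δ) * (H x - H y) := by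
  simp only [perturbW, add_mul, sum_add_distrib, mul_assoc, ite_mul, one_mul, zero_mul,
    ← mul_sum, sum_ite_eq', mem_univ, if_true]
  ring

lemma perturbW_perm (τ : Equiv.Perm (Fin k)) (a j : Fin k) :
    perturbW k δ (τ a) (τ j) = perturbW k δ a j := by
  simp [perturbW]

lemma profW_nonneg (hδ : δ ∈ Set.Ioo (0 : ℝ) 1) (a b : Fin m → Fin k) :
    0 ≤ profW m k δ a b :=
  prod_nonneg fun _ _ => perturbW_nonneg hδ _ _

lemma sum_profW (a : Fin m → Fin k) : ∑ b, profW m k δ a b = 1 := by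
  simp only [profW]
  rw [← Fintype.prod_sum (fun i j => perturbW k δ (a i) j)]
  simp [sum_perturbW]

lemma perturbExp_reindex (σ : Equiv.Perm (Fin m)) (a : Fin m → Fin k)
    (F : (Fin m → Fin k) → ℝ) :
    perturbExp δ a F = perturbExp δ (a ∘ σ) fun b => F (b ∘ σ.symm) := by
  unfold perturbExp
  refine Fintype.sum_equiv (σ.symm.arrowCongr (Equiv.refl _)) _ _ fun b => ?_
  have hF : (σ.symm.arrowCongr (Equiv.refl (Fin k)) b) ∘ σ.symm = b := by
    ext i; simp
  simp only [hF]
  congr 1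
  exact (Equiv.prod_comp σ fun i => perturbW k δ (a i) (b i)).symm

lemma perturbExp_perm (τ : Equiv.Perm (Fin k)) (a : Fin m → Fin k)
    (F : (Fin m → Fin k) → ℝ) :
    perturbExp δ a (fun b => F (τ ∘ b)) = perturbExp δ (τ ∘ a) F := by
  unfold perturbExp
  refine Fintype.sum_equiv ((Equiv.refl _).arrowCongr τ) _ _ fun b => ?_
  have hF : (Equiv.refl (Fin m)).arrowCongr τ b = τ ∘ b := rfl
  rw [hF]
  simp [profW, perturbW_perm]

lemma perturbExp_cons (a : Fin (m + 1) → Fin k) (F : (Fin (m + 1) → Fin k) → ℝ) :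
    perturbExp δ a F =
      ∑ c, perturbW k δ (a 0) c * perturbExp δ (Fin.tail a) fun b => F (Fin.cons c b) := by
  unfold perturbExp
  rw [← (Fin.consEquiv fun _ : Fin (m + 1) => Fin k).sum_comp, Fintype.sum_prod_type]
  refine sum_congr rfl fun c _ => ?_
  rw [mul_sum]
  refine sum_congr rfl fun b _ => ?_
  simp [profW, Fin.prod_univ_succ, Fin.consEquiv, Fin.tail, mul_assoc]

lemma perturbExp_sub_of_eq_off (a b : Fin (m + 2) → Fin k) (i j : Fin (m + 2)) (hij : i ≠ j)
    (hab : ∀ l, l ≠ j → a l = b l) : ∃ (r : Fin m → Fin k) (σ : Equiv.Perm (Fin (m + 2))),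
      σ 0 = i ∧ ∀ F : (Fin (m + 2) → Fin k) → ℝ, perturbExp δ a F - perturbExp δ b F =
        (1 - δ) * ∑ c, perturbW k δ (a i) c *
          (perturbExp δ r (fun s => F (Fin.cons c (Fin.cons (a j) s) ∘ σ.symm)) -
            perturbExp δ r (fun s => F (Fin.cons c (Fin.cons (b j) s) ∘ σ.symm))) := by
  obtain ⟨σ, h0, h1⟩ : ∃ σ : Equiv.Perm (Fin (m + 2)), σ 0 = i ∧ σ 1 = j := by
    refine ⟨Equiv.swap (Equiv.swap 0 i 1) j * Equiv.swap 0 i, ?_, ?_⟩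
    · rw [Equiv.Perm.mul_apply, Equiv.swap_apply_left]
      refine Equiv.swap_apply_of_ne_of_ne (fun h => ?_) hij
      have := (Equiv.swap 0 i).injective ((Equiv.swap_apply_left 0 i).trans h)
      simp at this
    · simp
  refine ⟨Fin.tail (Fin.tail (a ∘ σ)), σ, h0, fun F => ?_⟩
  have hr : Fin.tail (Fin.tail (b ∘ σ)) = Fin.tail (Fin.tail (a ∘ σ)) := by
    ext l
    have : σ l.succ.succ ≠ j := by
      rw [← h1, σ.injective.ne_iff]
      intro h
      rw [← Fin.succ_zero_eq_one] at h
      exact Fin.succ_ne_zero _ (Fin.succ_injective _ h)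
    simp [Fin.tail, hab _ this]
  have h1' : ∀ p : Fin (m + 2) → Fin k, Fin.tail (p ∘ σ) 0 = p j := fun p => by
    simp [Fin.tail, h1]
  rw [perturbExp_reindex σ a, perturbExp_reindex σ b, perturbExp_cons, perturbExp_cons]
  simp only [Function.comp_apply, h0, ← hab i hij]
  rw [← sum_sub_distrib, mul_sum]
  refine sum_congr rfl fun c _ => ?_
  rw [← mul_sub, perturbExp_cons, perturbExp_cons, h1', h1', hr, sum_perturbW_sub]
  ring

end Perturbation

section TotalVariation

variable {m k : ℕ} {δ : ℝ}

lemma perturbExp_comp_eq_sum (a : Fin m → Fin k) (v : Fin k → ℤ) (f : (Fin k → ℤ) → ℝ)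
    (S : Finset (Fin k → ℤ)) (hS : ∀ b, v + countVec m k b ∈ S) :
    perturbExp δ a (fun b => f (v + countVec m k b)) =
      ∑ x ∈ S, shiftCountDist m k δ a v x * f x := by
  simp only [perturbExp, shiftCountDist, sum_mul]
  rw [sum_comm]
  refine sum_congr rfl fun b _ => ?_
  simp [hS b]

lemma tsum_shiftCountDist (a : Fin m → Fin k) (v : Fin k → ℤ) (A : Set (Fin k → ℤ)) :
    ∑' x : A, shiftCountDist m k δ a v x =
      perturbExp δ a fun b => A.indicator 1 (v + countVec m k b) := by
  classical
  rw [tsum_subtype A (shiftCountDist m k δ a v),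
    tsum_eq_sum (s := univ.image fun b => v + countVec m k b)]
  · rw [perturbExp_comp_eq_sum a v (A.indicator 1) _ fun b =>
      mem_image_of_mem (fun b => v + countVec m k b) (mem_univ b)]
    refine sum_congr rfl fun x _ => ?_
    by_cases h : x ∈ A <;> simp [h]
  · intro x hx
    refine Set.indicator_apply_eq_zero.2 fun _ => sum_eq_zero fun b _ => ?_
    rw [if_neg, mul_zero]
    rintro rfl
    exact hx (mem_image_of_mem _ (mem_univ b))

lemma perturbExp_nonneg (hδ : δ ∈ Set.Ioo (0 : ℝ) 1) (a : Fin m → Fin k)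
    {F : (Fin m → Fin k) → ℝ} (hF : ∀ b, 0 ≤ F b) : 0 ≤ perturbExp δ a F :=
  sum_nonneg fun _ _ => mul_nonneg (profW_nonneg hδ _ _) (hF _)

lemma perturbExp_le_one (hδ : δ ∈ Set.Ioo (0 : ℝ) 1) (a : Fin m → Fin k)
    {F : (Fin m → Fin k) → ℝ} (hF : ∀ b, F b ≤ 1) : perturbExp δ a F ≤ 1 := by
  rw [← sum_profW (δ := δ) a]
  exact sum_le_sum fun b _ => mul_le_of_le_one_right (profW_nonneg hδ _ _) (hF b)

lemma indicator_one_mem_Icc {α : Type*} (A : Set α) (x : α) :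
    A.indicator (1 : α → ℝ) x ∈ Set.Icc (0 : ℝ) 1 := by
  by_cases h : x ∈ A <;> simp [h]

lemma le_dTV_shiftCountDist (hδ : δ ∈ Set.Ioo (0 : ℝ) 1) (a : Fin m → Fin k)
    (v w : Fin k → ℤ) (A : Set (Fin k → ℤ)) :
    |perturbExp δ a (fun b => A.indicator 1 (v + countVec m k b)) -
        perturbExp δ a (fun b => A.indicator 1 (w + countVec m k b))| ≤
      dTV (shiftCountDist m k δ a v) (shiftCountDist m k δ a w) := by
  refine le_csSup ⟨1, ?_⟩ ⟨A, by simp only [tsum_shiftCountDist]⟩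
  rintro _ ⟨B, rfl⟩
  rw [tsum_shiftCountDist, tsum_shiftCountDist]
  have h (u : Fin k → ℤ) :
      perturbExp δ a (fun b => B.indicator 1 (u + countVec m k b)) ∈ Set.Icc (0 : ℝ) 1 :=
    ⟨perturbExp_nonneg hδ a fun _ => (indicator_one_mem_Icc _ _).1,
      perturbExp_le_one hδ a fun _ => (indicator_one_mem_Icc _ _).2⟩
  rw [abs_le]
  constructor <;> linarith [(h v).1, (h v).2, (h w).1, (h w).2]

lemma perturbExp_sub_le_dTV (hδ : δ ∈ Set.Ioo (0 : ℝ) 1) (a : Fin m → Fin k)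
    (v w : Fin k → ℤ) (f : (Fin k → ℤ) → ℝ) (hf : ∀ x, f x ∈ Set.Icc (0 : ℝ) 1) :
    |perturbExp δ a (fun b => f (v + countVec m k b)) -
        perturbExp δ a (fun b => f (w + countVec m k b))| ≤
      dTV (shiftCountDist m k δ a v) (shiftCountDist m k δ a w) := by
  classical
  set P := shiftCountDist m k δ a v
  set Q := shiftCountDist m k δ a w
  set S : Finset (Fin k → ℤ) :=
    (univ.image fun b => v + countVec m k b) ∪ (univ.image fun b => w + countVec m k b)
  have hv (b) : v + countVec m k b ∈ S := mem_union_left _ (mem_image_of_mem _ (mem_univ b))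
  have hw (b) : w + countVec m k b ∈ S := mem_union_right _ (mem_image_of_mem _ (mem_univ b))
  have key (f : (Fin k → ℤ) → ℝ) : perturbExp δ a (fun b => f (v + countVec m k b)) -
        perturbExp δ a (fun b => f (w + countVec m k b)) = ∑ x ∈ S, (P x - Q x) * f x := by
    rw [perturbExp_comp_eq_sum a v f S hv, perturbExp_comp_eq_sum a w f S hw, ← sum_sub_distrib]
    simp only [sub_mul, P, Q]
  rw [key, abs_le']
  constructor
  · refine le_trans ?_ ((le_abs_self _).trans (le_dTV_shiftCountDist hδ a v w {x | Q x ≤ P x}))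
    rw [key]
    refine sum_le_sum fun x _ => ?_
    by_cases h : Q x ≤ P x
    · simpa [h] using mul_le_of_le_one_right (sub_nonneg.2 h) (hf x).2
    · simpa [h] using mul_nonpos_of_nonpos_of_nonneg (by linarith) (hf x).1
  · refine le_trans ?_ ((neg_le_abs _).trans (le_dTV_shiftCountDist hδ a v w {x | P x ≤ Q x}))
    rw [key, neg_le_neg_iff]
    refine sum_le_sum fun x _ => ?_
    by_cases h : P x ≤ Q x
    · simp only [Set.indicator, Set.mem_ofPred_eq, h, if_true, Pi.one_apply]
      nlinarith [(hf x).2]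
    · simpa [h] using mul_nonneg (by linarith) (hf x).1

lemma countVec_comp_perm (τ : Equiv.Perm (Fin k)) (b : Fin m → Fin k) :
    countVec m k (τ ∘ b) ∘ τ = countVec m k b := by
  ext j; simp [countVec]

lemma basisVec_comp_perm (τ : Equiv.Perm (Fin k)) (x : Fin k) :
    basisVec k (τ x) ∘ τ = basisVec k x := by
  ext j; simp [basisVec]

/-- The event discrepancy between two shifts by distinct basis vectors is controlled by the shifts
by any other two distinct basis vectors, up to relabelling the actions. -/
lemma exists_perturbExp_sub_le_dTV (hδ : δ ∈ Set.Ioo (0 : ℝ) 1) (a : Fin m → Fin k)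
    {x y x' y' : Fin k} (hxy : x ≠ y) (hxy' : x' ≠ y') :
    ∃ a' : Fin m → Fin k, ∀ f : (Fin k → ℤ) → ℝ, (∀ u, f u ∈ Set.Icc (0 : ℝ) 1) →
      |perturbExp δ a (fun b => f (basisVec k x + countVec m k b)) -
          perturbExp δ a (fun b => f (basisVec k y + countVec m k b))| ≤
        dTV (shiftCountDist m k δ a' (basisVec k x')) (shiftCountDist m k δ a' (basisVec k y')) := by
  obtain ⟨τ, hx, hy⟩ : ∃ τ : Equiv.Perm (Fin k), τ x = x' ∧ τ y = y' := by
    refine ⟨Equiv.swap (Equiv.swap x x' y) y' * Equiv.swap x x', ?_, by simp⟩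
    rw [Equiv.Perm.mul_apply, Equiv.swap_apply_left]
    refine Equiv.swap_apply_of_ne_of_ne (fun h => ?_) hxy'
    exact hxy ((Equiv.swap x x').injective ((Equiv.swap_apply_left x x').trans h))
  refine ⟨τ ∘ a, fun f hf => ?_⟩
  have h (z : Fin k) : perturbExp δ a (fun b => f (basisVec k z + countVec m k b)) =
      perturbExp δ (τ ∘ a) fun b => f ((basisVec k (τ z) + countVec m k b) ∘ τ) := by
    rw [← perturbExp_perm]
    congr! 3 with b
    rw [← basisVec_comp_perm τ z, ← countVec_comp_perm τ b]
    rfl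
  rw [h, h, hx, hy]
  exact perturbExp_sub_le_dTV hδ _ _ _ (fun u => f (u ∘ τ)) fun u => hf _

end TotalVariation

section Games

variable {m k : ℕ} {δ : ℝ}

lemma countVec_comp_equiv (σ : Equiv.Perm (Fin m)) (p : Fin m → Fin k) :
    countVec m k (p ∘ σ) = countVec m k p := by
  ext j
  simp only [countVec, Function.comp_apply, Nat.cast_inj]
  exact card_equiv σ (by simp)

lemma countVec_cons (c : Fin k) (p : Fin m → Fin k) :
    countVec (m + 1) k (Fin.cons c p) = basisVec k c + countVec m k p := by
  ext j
  simp only [countVec, basisVec, card_filter, Fin.sum_univ_succ, Fin.cons_zero, Fin.cons_succ,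
    Pi.add_apply, eq_comm (a := j)]
  push_cast
  rfl

/-- In an anonymous game, the payoff of player `i` is a function of his own action and the
counts of the other players' actions. -/
lemma IsAnonymous.exists_factor {g : (Fin m → Fin k) → Fin m → ℝ}
    (hg : IsGame m k g) (ha : IsAnonymous m k g) (i : Fin m) (c : Fin k) :
    ∃ f : (Fin k → ℤ) → ℝ, (∀ u, f u ∈ Set.Icc (0 : ℝ) 1) ∧
      ∀ p u, p i = c → countVec m k p = basisVec k c + u → g p i = f u := by
  classical
  refine ⟨fun u => if h : ∃ p, p i = c ∧ countVec m k p = basisVec k c + u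
    then g h.choose i else 0, fun u => ?_, fun p u hp hu => ?_⟩
  · dsimp only
    split_ifs with h
    · exact hg _ _
    · simp
  · have h : ∃ p, p i = c ∧ countVec m k p = basisVec k c + u := ⟨p, hp, hu⟩
    simp only [dif_pos h]
    refine ha _ _ _ (hp.trans h.choose_spec.1.symm) fun j => ?_
    exact Int.ofNat_inj.1 (congrFun (hu.trans h.choose_spec.2.symm) j)

lemma exists_eq_off_of_card_ne_eq_one {a b : Fin m → Fin k}
    (h : (univ.filter fun j => a j ≠ b j).card = 1) :
    ∃ j, a j ≠ b j ∧ ∀ l, l ≠ j → a l = b l := by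
  obtain ⟨j, hj⟩ := card_eq_one.1 h
  simp only [Finset.ext_iff, mem_filter, mem_univ, true_and, mem_singleton] at hj
  exact ⟨j, (hj j).2 rfl, fun l hl => not_not.1 fun h => hl ((hj l).1 h)⟩

/-- The largest total variation distance between `e_x + N(a^δ)` and `e_y + N(a^δ)`. -/
noncomputable def maxShiftTV (m : ℕ) (δ : ℝ) (x y : Fin k) : ℝ :=
  sSup {t | ∃ a : Fin m → Fin k,
    t = dTV (shiftCountDist m k δ a (basisVec k x)) (shiftCountDist m k δ a (basisVec k y))}

lemma dTV_le_maxShiftTV (a : Fin m → Fin k) (x y : Fin k) :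
    dTV (shiftCountDist m k δ a (basisVec k x)) (shiftCountDist m k δ a (basisVec k y)) ≤
      maxShiftTV m δ x y := by
  refine le_csSup (Set.Finite.bddAbove ?_) ⟨a, rfl⟩
  refine (Set.finite_range fun a : Fin m → Fin k =>
    dTV (shiftCountDist m k δ a (basisVec k x)) (shiftCountDist m k δ a (basisVec k y))).subset ?_
  rintro _ ⟨a, rfl⟩
  exact ⟨a, rfl⟩

lemma dTV_nonneg {α : Type*} (P Q : α → ℝ) : 0 ≤ dTV P Q :=
  Real.sSup_nonneg (by rintro _ ⟨A, rfl⟩; exact abs_nonneg _)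

lemma maxShiftTV_nonneg (x y : Fin k) : 0 ≤ maxShiftTV m δ x y :=
  Real.sSup_nonneg (by rintro _ ⟨a, rfl⟩; exact dTV_nonneg _ _)

lemma abs_perturbGame_sub_le (hδ : δ ∈ Set.Ioo (0 : ℝ) 1) {x y : Fin k} (hxy : x ≠ y)
    {g : (Fin (m + 2) → Fin k) → Fin (m + 2) → ℝ} (hg : IsGame (m + 2) k g)
    (ha : IsAnonymous (m + 2) k g) (i : Fin (m + 2)) {a b : Fin (m + 2) → Fin k}
    (hi : a i = b i) (hab : (univ.filter fun j => a j ≠ b j).card = 1) :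
    |perturbGame (m + 2) k δ g a i - perturbGame (m + 2) k δ g b i| ≤
      (1 - δ) * maxShiftTV m δ x y := by
  obtain ⟨j, hj, hoff⟩ := exists_eq_off_of_card_ne_eq_one hab
  have hij : i ≠ j := by rintro rfl; exact hj hi
  obtain ⟨r, σ, hσ, hF⟩ := perturbExp_sub_of_eq_off (δ := δ) a b i j hij hoff
  obtain ⟨r', hr'⟩ := exists_perturbExp_sub_le_dTV hδ r hj hxy
  have hσ' : σ.symm i = 0 := by simp [← hσ]
  change |perturbExp δ a (fun p => g p i) - perturbExp δ b (fun p => g p i)| ≤ _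
  rw [hF, abs_mul, abs_of_pos (sub_pos.2 hδ.2)]
  refine mul_le_mul_of_nonneg_left ?_ (sub_pos.2 hδ.2).le
  refine (abs_sum_le_sum_abs _ _).trans ?_
  rw [← one_mul (maxShiftTV m δ x y), ← sum_perturbW (δ := δ) (a i), sum_mul]
  refine sum_le_sum fun c _ => ?_
  rw [abs_mul, abs_of_nonneg (perturbW_nonneg hδ _ _)]
  refine mul_le_mul_of_nonneg_left ?_ (perturbW_nonneg hδ _ _)
  obtain ⟨f, hf, hgf⟩ := ha.exists_factor hg i c
  have h (z : Fin k) (s : Fin m → Fin k) :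
      g (Fin.cons c (Fin.cons z s) ∘ σ.symm) i = f (basisVec k z + countVec m k s) :=
    hgf _ _ (by simp [hσ']) (by rw [countVec_comp_equiv, countVec_cons, countVec_cons])
  simp only [h]
  exact (hr' f hf).trans (dTV_le_maxShiftTV _ _ _)

/-- The anonymous game in which every player is paid `1` exactly when the counts of the other
players' actions lie in `A`. -/
noncomputable def eventGame (n k : ℕ) (A : Set (Fin k → ℤ)) :
    (Fin n → Fin k) → Fin n → ℝ :=
  fun p i => A.indicator 1 (countVec n k p - basisVec k (p i))

lemma isGame_eventGame (A : Set (Fin k → ℤ)) : IsGame m k (eventGame m k A) :=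
  fun _ _ => indicator_one_mem_Icc _ _

lemma isAnonymous_eventGame (A : Set (Fin k → ℤ)) : IsAnonymous m k (eventGame m k A) := by
  intro a b i hi h
  have hc : countVec m k a = countVec m k b := funext fun j => congrArg Nat.cast (h j)
  simp only [eventGame, hi, hc]

lemma exists_perturbGame_eventGame_sub (r : Fin m → Fin k) {x y : Fin k} (hxy : x ≠ y)
    (A : Set (Fin k → ℤ)) : ∃ (i : Fin (m + 2)) (a b : Fin (m + 2) → Fin k), a i = b i ∧
      (univ.filter fun j => a j ≠ b j).card = 1 ∧
      perturbGame (m + 2) k δ (eventGame (m + 2) k A) a i -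
          perturbGame (m + 2) k δ (eventGame (m + 2) k A) b i =
        (1 - δ) * (perturbExp δ r (fun s => A.indicator 1 (basisVec k x + countVec m k s)) -
          perturbExp δ r (fun s => A.indicator 1 (basisVec k y + countVec m k s))) := by
  refine ⟨0, Fin.cons x (Fin.cons x r), Fin.cons x (Fin.cons y r), rfl, ?_, ?_⟩
  · refine card_eq_one.2 ⟨1, ?_⟩
    ext l
    refine Fin.cases (by simp) (fun l => Fin.cases (by simpa using hxy) (fun l => ?_) l) l
    simp only [Fin.cons_succ, mem_filter, mem_univ, true_and, mem_singleton]
    simp [Fin.ext_iff]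
  · change perturbExp δ _ (fun p => eventGame (m + 2) k A p 0) -
      perturbExp δ _ (fun p => eventGame (m + 2) k A p 0) = _
    have h (c z : Fin k) (s : Fin m → Fin k) :
        eventGame (m + 2) k A (Fin.cons c (Fin.cons z s)) 0 =
          A.indicator 1 (basisVec k z + countVec m k s) := by
      simp [eventGame, countVec_cons]
    rw [perturbExp_cons, perturbExp_cons]
    simp only [Fin.cons_zero, Fin.tail_cons]
    rw [← sum_sub_distrib]
    simp only [← mul_sub, perturbExp_cons (Fin.cons _ r), Fin.cons_zero, Fin.tail_cons, h,
      sum_perturbW_sub]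
    rw [← sum_mul, sum_perturbW, one_mul]

lemma lipC_perturbGame_le (hδ : δ ∈ Set.Ioo (0 : ℝ) 1) {x y : Fin k} (hxy : x ≠ y)
    {g : (Fin (m + 2) → Fin k) → Fin (m + 2) → ℝ} (hg : IsGame (m + 2) k g)
    (ha : IsAnonymous (m + 2) k g) :
    lipC (m + 2) k (perturbGame (m + 2) k δ g) ≤ (1 - δ) * maxShiftTV m δ x y := by
  refine Real.sSup_le ?_ (mul_nonneg (sub_pos.2 hδ.2).le (maxShiftTV_nonneg x y))
  rintro _ ⟨i, a, b, hi, hab, rfl⟩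
  exact abs_perturbGame_sub_le hδ hxy hg ha i hi hab

lemma le_lam (hδ : δ ∈ Set.Ioo (0 : ℝ) 1) {x y : Fin k} (hxy : x ≠ y) (r : Fin m → Fin k)
    (A : Set (Fin k → ℤ)) :
    (1 - δ) * |perturbExp δ r (fun s => A.indicator 1 (basisVec k x + countVec m k s)) -
        perturbExp δ r (fun s => A.indicator 1 (basisVec k y + countVec m k s))| ≤
      lam (m + 2) k δ := by
  have hg := isGame_eventGame (m := m + 2) A
  have ha := isAnonymous_eventGame (m := m + 2) A
  obtain ⟨i, a, b, hi, hab, h⟩ := exists_perturbGame_eventGame_sub (δ := δ) r hxy A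
  calc _ = |perturbGame (m + 2) k δ (eventGame (m + 2) k A) a i -
          perturbGame (m + 2) k δ (eventGame (m + 2) k A) b i| := by
        rw [h, abs_mul, abs_of_pos (sub_pos.2 hδ.2)]
    _ ≤ lipC (m + 2) k (perturbGame (m + 2) k δ (eventGame (m + 2) k A)) := by
        refine le_csSup ⟨(1 - δ) * maxShiftTV m δ x y, ?_⟩ ⟨i, a, b, hi, hab, rfl⟩
        rintro _ ⟨i, a, b, hi, hab, rfl⟩
        exact abs_perturbGame_sub_le hδ hxy hg ha i hi hab
    _ ≤ lam (m + 2) k δ := by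
        refine le_csSup ⟨(1 - δ) * maxShiftTV m δ x y, ?_⟩ ⟨_, hg, ha, rfl⟩
        rintro _ ⟨g, hg, ha, rfl⟩
        exact lipC_perturbGame_le hδ hxy hg ha

theorem lam_eq_maxShiftTV (hδ : δ ∈ Set.Ioo (0 : ℝ) 1) {x y : Fin k} (hxy : x ≠ y) :
    lam (m + 2) k δ = (1 - δ) * maxShiftTV m δ x y := by
  have hδ' : 0 < 1 - δ := sub_pos.2 hδ.2
  refine le_antisymm (Real.sSup_le ?_ (mul_nonneg hδ'.le (maxShiftTV_nonneg x y))) ?_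
  · rintro _ ⟨g, hg, ha, rfl⟩
    exact lipC_perturbGame_le hδ hxy hg ha
  · rw [← le_div_iff₀' hδ']
    have h0 : 0 ≤ lam (m + 2) k δ / (1 - δ) := div_nonneg
      ((mul_nonneg hδ'.le (abs_nonneg _)).trans (le_lam hδ hxy (fun _ => x) ∅)) hδ'.le
    refine Real.sSup_le ?_ h0
    rintro _ ⟨r, rfl⟩
    refine Real.sSup_le ?_ h0
    rintro _ ⟨A, rfl⟩
    rw [le_div_iff₀' hδ', tsum_shiftCountDist, tsum_shiftCountDist]
    exact le_lam hδ hxy r A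

end Games

/-- For every `n ≥ 2`, `k ≥ 2`, and `δ ∈ (0,1)`, the worst-case Lipschitz constant
of `δ`-perturbed anonymous games equals
`(1-δ)·max_{a ∈ [k]^{n-2}} d_TV(e_1 + N(a^δ), e_2 + N(a^δ))`. -/
theorem lipschitz_constant_eq_tv (n k : ℕ) (hn : 2 ≤ n) (hk : 2 ≤ k)
    (δ : ℝ) (hδ : δ ∈ Set.Ioo (0 : ℝ) 1) :
    lam n k δ = (1 - δ) *
      sSup {x | ∃ a : Fin (n - 2) → Fin k,
        x = dTV (shiftCountDist (n - 2) k δ a (basisVec k ⟨0, by omega⟩))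
              (shiftCountDist (n - 2) k δ a (basisVec k ⟨1, by omega⟩))} := by
  obtain ⟨m, rfl⟩ := Nat.exists_eq_add_of_le' hn
  exact lam_eq_maxShiftTV hδ (by simp)
end

section
/- For every n ≥ 1 and δ ∈ (0,1), P_{⌈n/2⌉} ≤ M(n,δ) ≤ √(P_{⌈n/2⌉}·P_{⌊n/2⌋}), where, for X_1, X_2, … i.i.d. Bernoulli(δ/2) random variables, M(n,δ) = max_{l,s ∈ {0,…,n}} P(Σ_{i=1}^{l} X_i + Σ_{j=l+1}^{n} (1-X_j) = s) and P_m = P(Σ_{i=1}^{m} X_i + Σ_{j=m+1}^{2m} (1-X_j) = m). -/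
/-- The probability of the event `E` when `ω : Fin n → Bool` is a vector of `n`
i.i.d. Bernoulli(`p`) random variables (`true` has probability `p`). -/
noncomputable def bernProb (n : ℕ) (p : ℝ) (E : (Fin n → Bool) → Prop)
    [DecidablePred E] : ℝ :=
  ∑ ω : Fin n → Bool, (∏ i, if ω i then p else 1 - p) * (if E ω then 1 else 0)

/-- `{0,1}`-valued indicator of a Boolean. -/
def bInd (b : Bool) : ℕ := if b then 1 else 0

/-- The statistic `Σ_{i=1}^{l} X_i + Σ_{j=l+1}^{n} (1 - X_j)` for the outcome `ω`. -/
def bStat (n l : ℕ) (ω : Fin n → Bool) : ℕ :=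
  ∑ i : Fin n, if (i : ℕ) < l then bInd (ω i) else 1 - bInd (ω i)

/-- `M(n,δ) = max_{l,s ∈ {0,…,n}} P(Σ_{i=1}^{l} X_i + Σ_{j=l+1}^{n} (1-X_j) = s)`,
where `X_1, X_2, …` are i.i.d. Bernoulli(`δ/2`); `M(0,δ) = 1`. -/
noncomputable def Mmax (n : ℕ) (δ : ℝ) : ℝ :=
  sSup {x | ∃ l s : ℕ, l ≤ n ∧ s ≤ n ∧ x = bernProb n (δ / 2) (fun ω => bStat n l ω = s)}

/-- `P_m = P(Σ_{i=1}^{m} X_i + Σ_{j=m+1}^{2m} (1-X_j) = m)`, where `X_1, X_2, …`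
are i.i.d. Bernoulli(`δ/2`). -/
noncomputable def Pdiag (m : ℕ) (δ : ℝ) : ℝ :=
  bernProb (2 * m) (δ / 2) (fun ω => bStat (2 * m) m ω = m)

/-- A product over `Fin n` that takes the value `a` before `l` and `b` from `l` on. -/
lemma Fin.prod_ite_lt_eq_pow {M : Type*} [CommMonoid M] (n l : ℕ) (hl : l ≤ n) (a b : M) :
    (∏ i : Fin n, if (i : ℕ) < l then a else b) = a ^ l * b ^ (n - l) := by
  obtain ⟨k, rfl⟩ := Nat.exists_eq_add_of_le hl
  rw [Fin.prod_univ_add]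
  simp

open Polynomial in
/-- The law of `bStat n l` has generating polynomial `(q + p X) ^ l * (p + q X) ^ (n - l)`. -/
lemma bernProb_bStat_eq_coeff (n l s : ℕ) (hl : l ≤ n) (p : ℝ) :
    bernProb n p (fun ω => bStat n l ω = s) =
      ((C (1 - p) + C p * X) ^ l * (C p + C (1 - p) * X) ^ (n - l)).coeff s := by
  have factor (i : Fin n) :
      (if (i : ℕ) < l then C (1 - p) + C p * X else C p + C (1 - p) * X : ℝ[X]) =
        ∑ b : Bool, C (if b then p else 1 - p) *
          X ^ (if (i : ℕ) < l then bInd b else 1 - bInd b) := by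
    split_ifs <;> simp [bInd, add_comm]
  rw [← Fin.prod_ite_lt_eq_pow n l hl, Finset.prod_congr rfl fun i _ => factor i,
    Finset.prod_univ_sum, Fintype.piFinset_univ, finsetSum_coeff, bernProb]
  refine Finset.sum_congr rfl fun ω _ => ?_
  rw [Finset.prod_mul_distrib, ← map_prod, Finset.prod_pow_eq_pow_sum, coeff_C_mul, coeff_X_pow]
  simp only [bStat, eq_comm]

open Polynomial in
lemma natDegree_linear_pow_le {R : Type*} [CommSemiring R] (a b : R) (k : ℕ) :
    ((C a + C b * X) ^ k).natDegree ≤ k := by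
  compute_degree

open Polynomial in
lemma reflect_linear_pow {R : Type*} [CommSemiring R] (a b : R) (k : ℕ) :
    reflect k ((C a + C b * X) ^ k) = (C b + C a * X) ^ k := by
  induction k with
  | zero => simp [reflect_one]
  | succ k ih =>
    have linear : reflect 1 (C a + C b * X) = C b + C a * X := by
      have hX : reflect 1 (X : R[X]) = 1 := by
        simp
      rw [reflect_add, reflect_C, reflect_C_mul, hX, pow_one, mul_one, add_comm]
    rw [pow_succ, reflect_mul _ _ (natDegree_linear_pow_le a b k)
      (by simpa only [pow_one] using natDegree_linear_pow_le a b 1), ih, linear, pow_succ]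

open Polynomial in
lemma sum_sq_coeff_eq_coeff_mul_reflect {R : Type*} [CommSemiring R] (f : R[X]) (m : ℕ) :
    ∑ k ∈ Finset.range (m + 1), f.coeff k ^ 2 = (f * reflect m f).coeff m := by
  rw [coeff_mul, Finset.Nat.sum_antidiagonal_eq_sum_range_succ_mk]
  refine Finset.sum_congr rfl fun k hk => ?_
  have hk : k ≤ m := by simpa [Nat.lt_succ_iff] using hk
  rw [coeff_reflect, revAt_le (Nat.sub_le m k), Nat.sub_sub_self hk, sq]

open Polynomial in
/-- Cauchy–Schwarz for the coefficients of a product. -/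
lemma coeff_mul_sq_le {f g : ℝ[X]} {a b : ℕ} (hf : f.natDegree ≤ a) (hg : g.natDegree ≤ b)
    (s : ℕ) :
    (f * g).coeff s ^ 2 ≤
      (∑ k ∈ Finset.range (a + 1), f.coeff k ^ 2) *
        ∑ k ∈ Finset.range (b + 1), g.coeff k ^ 2 := by
  have sum_le {h : ℝ[X]} {m : ℕ} (hh : h.natDegree ≤ m) :
      ∑ k ∈ Finset.range (s + 1), h.coeff k ^ 2 ≤
        ∑ k ∈ Finset.range (m + 1), h.coeff k ^ 2 := by
    rw [Finset.sum_subset (Finset.range_subset_range.2 (by lia : m + 1 ≤ m + s + 1))]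
    · exact Finset.sum_le_sum_of_subset_of_nonneg (Finset.range_subset_range.2 (by lia))
        fun _ _ _ => sq_nonneg _
    · intro k _ hk
      rw [coeff_eq_zero_of_natDegree_lt (by simp at hk; lia), zero_pow two_ne_zero]
  rw [coeff_mul]
  refine (Finset.sum_mul_sq_le_sq_mul_sq _ _ _).trans ?_
  have hfst : ∑ x ∈ Finset.HasAntidiagonal.antidiagonal s, f.coeff x.1 ^ 2 =
      ∑ k ∈ Finset.range (s + 1), f.coeff k ^ 2 :=
    Finset.Nat.sum_antidiagonal_eq_sum_range_succ_mk (fun x => f.coeff x.1 ^ 2) s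
  have hsnd : ∑ x ∈ Finset.HasAntidiagonal.antidiagonal s, g.coeff x.2 ^ 2 =
      ∑ k ∈ Finset.range (s + 1), g.coeff k ^ 2 := by
    rw [← Finset.Nat.sum_antidiagonal_swap]
    exact Finset.Nat.sum_antidiagonal_eq_sum_range_succ_mk (fun x => g.coeff x.1 ^ 2) s
  rw [hfst, hsnd]
  exact mul_le_mul (sum_le hf) (sum_le hg) (by positivity) (by positivity)

open Polynomial in
lemma Pdiag_eq_coeff (m : ℕ) (δ : ℝ) :
    Pdiag m δ =
      ((C (1 - δ / 2) + C (δ / 2) * X) ^ m * (C (δ / 2) + C (1 - δ / 2) * X) ^ m).coeff m := by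
  rw [Pdiag, bernProb_bStat_eq_coeff _ _ _ (by lia), two_mul, Nat.add_sub_cancel]

open Polynomial in
lemma natDegree_linear_pow_mul_le (a b c d : ℝ) (i j : ℕ) :
    ((C a + C b * X) ^ i * (C c + C d * X) ^ j).natDegree ≤ i + j := by
  compute_degree

open Polynomial in
/-- However many of the `m` variables are flipped, the collision probability of the sum
is `Pdiag m δ`. -/
lemma sum_sq_coeff_eq_Pdiag (i j : ℕ) (δ : ℝ) :
    ∑ k ∈ Finset.range (i + j + 1),
      ((C (1 - δ / 2) + C (δ / 2) * X) ^ i * (C (δ / 2) + C (1 - δ / 2) * X) ^ j).coeff k ^ 2 =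
      Pdiag (i + j) δ := by
  rw [sum_sq_coeff_eq_coeff_mul_reflect, Pdiag_eq_coeff,
    reflect_mul _ _ (natDegree_linear_pow_le _ _ i) (natDegree_linear_pow_le _ _ j),
    reflect_linear_pow, reflect_linear_pow, pow_add, pow_add]
  generalize (C (1 - δ / 2) + C (δ / 2) * X) = f
  generalize (C (δ / 2) + C (1 - δ / 2) * X) = g
  congr 1
  ring

lemma bernProb_bStat_le_sqrt (n l s : ℕ) (hl : l ≤ n) (δ : ℝ) :
    bernProb n (δ / 2) (fun ω => bStat n l ω = s) ≤
      Real.sqrt (Pdiag ((n + 1) / 2) δ * Pdiag (n / 2) δ) := by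
  obtain ⟨i, j, i', j', hl', hn', hij, hij'⟩ : ∃ i j i' j' : ℕ,
      l = i + i' ∧ n - l = j + j' ∧ (n + 1) / 2 = i + j ∧ n / 2 = i' + j' :=
    ⟨min l ((n + 1) / 2), (n + 1) / 2 - l, l - (n + 1) / 2,
      n / 2 - (l - (n + 1) / 2), by lia, by lia, by lia, by lia⟩
  rw [bernProb_bStat_eq_coeff n l s hl, hn', hl', hij, hij', pow_add, pow_add,
    mul_mul_mul_comm, ← sum_sq_coeff_eq_Pdiag, ← sum_sq_coeff_eq_Pdiag]
  exact Real.le_sqrt_of_sq_le (coeff_mul_sq_le (natDegree_linear_pow_mul_le _ _ _ _ _ _)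
    (natDegree_linear_pow_mul_le _ _ _ _ _ _) s)

lemma bernProb_le_Mmax {n l s : ℕ} (hl : l ≤ n) (hs : s ≤ n) (δ : ℝ) :
    bernProb n (δ / 2) (fun ω => bStat n l ω = s) ≤ Mmax n δ := by
  refine le_csSup ⟨Real.sqrt (Pdiag ((n + 1) / 2) δ * Pdiag (n / 2) δ), ?_⟩ ⟨l, s, hl, hs, rfl⟩
  rintro x ⟨l, s, hl, -, rfl⟩
  exact bernProb_bStat_le_sqrt n l s hl δ

open Polynomial in
/-- Conditioning on the last variable. -/
lemma Pdiag_succ_eq (k : ℕ) (δ : ℝ) :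
    Pdiag (k + 1) δ =
      δ / 2 * bernProb (2 * k + 1) (δ / 2) (fun ω => bStat (2 * k + 1) (k + 1) ω = k + 1) +
      (1 - δ / 2) * bernProb (2 * k + 1) (δ / 2) (fun ω => bStat (2 * k + 1) (k + 1) ω = k) := by
  rw [Pdiag_eq_coeff, bernProb_bStat_eq_coeff _ _ _ (by lia),
    bernProb_bStat_eq_coeff _ _ _ (by lia), show 2 * k + 1 - (k + 1) = k by lia,
    pow_succ (C (δ / 2) + C (1 - δ / 2) * X), ← mul_assoc, mul_add, coeff_add, coeff_mul_C,
    mul_left_comm, coeff_C_mul, coeff_mul_X, mul_comm (δ / 2)]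

/-- For every `n ≥ 1` and `δ ∈ (0,1)`: `P_{⌈n/2⌉} ≤ M(n,δ) ≤ √(P_{⌈n/2⌉}·P_{⌊n/2⌋})`. -/
theorem Mmax_bounds (n : ℕ) (hn : 1 ≤ n) (δ : ℝ) (hδ : δ ∈ Set.Ioo (0 : ℝ) 1) :
    Pdiag ((n + 1) / 2) δ ≤ Mmax n δ ∧
      Mmax n δ ≤ Real.sqrt (Pdiag ((n + 1) / 2) δ * Pdiag (n / 2) δ) := by
  refine ⟨?_, ?_⟩
  · rcases Nat.even_or_odd' n with ⟨k, rfl | rfl⟩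
    · rw [show (2 * k + 1) / 2 = k by lia]
      exact bernProb_le_Mmax (by lia) (by lia) δ
    · rw [show (2 * k + 1 + 1) / 2 = k + 1 by lia, Pdiag_succ_eq]
      have h₁ := bernProb_le_Mmax (n := 2 * k + 1) (l := k + 1) (s := k + 1)
        (by lia) (by lia) δ
      have h₀ := bernProb_le_Mmax (n := 2 * k + 1) (l := k + 1) (s := k)
        (by lia) (by lia) δ
      obtain ⟨hδ₀, hδ₁⟩ := hδ
      calc _ ≤ δ / 2 * Mmax (2 * k + 1) δ + (1 - δ / 2) * Mmax (2 * k + 1) δ := by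
            gcongr
            linarith
        _ = Mmax (2 * k + 1) δ := by ring
  · refine csSup_le ⟨_, 0, 0, by lia, by lia, rfl⟩ ?_
    rintro x ⟨l, s, hl, -, rfl⟩
    exact bernProb_bStat_le_sqrt n l s hl δ
end

section
/- There exists a global constant C > 0 such that for every n ≥ 1 and every 0 < r ≤ 1, setting η = (π/2)·n·r, one has |P(S_n^r ∈ {0,1}) - η^{-1/2}| ≤ C/η, where (S_m^r) is the lazy symmetric random walk on ℤ with rate r. -/
theorem walk_eq_integral (r : ℝ) (n : ℕ) (z : ℤ) :
    walk r n z =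
      Real.pi⁻¹ * ∫ θ in (0 : ℝ)..Real.pi, (1 - r * (1 - Real.cos θ)) ^ n * Real.cos (z * θ) := by
  induction n generalizing z with
  | zero =>
    by_cases hz : z = 0
    · simp [walk, hz, Real.pi_ne_zero]
    · have hz_ne : (z : ℝ) ≠ 0 := by exact_mod_cast hz
      simp [walk, hz, intervalIntegral.integral_comp_mul_left _ hz_ne]
  | succ n ih =>
    have h_int : ∀ k : ℤ, IntervalIntegrable
        (fun θ : ℝ => (1 - r * (1 - Real.cos θ)) ^ n * Real.cos (k * θ))
        MeasureTheory.volume 0 Real.pi :=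
      fun k => (by fun_prop : Continuous _).intervalIntegrable _ _
    have hsum : (∫ θ in (0 : ℝ)..Real.pi,
          (1 - r * (1 - Real.cos θ)) ^ (n + 1) * Real.cos (z * θ)) =
        (1 - r) * (∫ θ in (0 : ℝ)..Real.pi, (1 - r * (1 - Real.cos θ)) ^ n * Real.cos (z * θ))
        + r / 2 * (∫ θ in (0 : ℝ)..Real.pi,
            (1 - r * (1 - Real.cos θ)) ^ n * Real.cos ((z - 1 : ℤ) * θ))
        + r / 2 * (∫ θ in (0 : ℝ)..Real.pi,
            (1 - r * (1 - Real.cos θ)) ^ n * Real.cos ((z + 1 : ℤ) * θ)) := by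
      simp only [← intervalIntegral.integral_const_mul]
      rw [← intervalIntegral.integral_add ((h_int _).const_mul _) ((h_int _).const_mul _),
        ← intervalIntegral.integral_add
          (((h_int _).const_mul _).add ((h_int _).const_mul _)) ((h_int _).const_mul _)]
      congr 1
      ext θ
      push_cast
      rw [sub_mul (z : ℝ), add_mul (z : ℝ), one_mul, Real.cos_sub, Real.cos_add]
      ring
    rw [walk, ih, ih, ih, hsum]
    ring

theorem sq_mul_exp_neg_le {y : ℝ} (hy : 0 ≤ y) : y ^ 2 * Real.exp (-y) ≤ 2 := by
  rw [Real.exp_neg, ← div_eq_mul_inv, div_le_iff₀ (Real.exp_pos y)]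
  nlinarith [Real.quadratic_le_exp_of_nonneg hy]

theorem mul_exp_neg_le_one (y : ℝ) : y * Real.exp (-y) ≤ 1 := by
  rw [Real.exp_neg, ← div_eq_mul_inv, div_le_iff₀ (Real.exp_pos y)]
  linarith [Real.add_one_le_exp y]

theorem exp_neg_sub_exp_neg_le (a b : ℝ) :
    Real.exp (-a) - Real.exp (-b) ≤ (b - a) * Real.exp (-a) := by
  have h : Real.exp (-b) = Real.exp (-a) * Real.exp (a - b) := by
    rw [← Real.exp_add]; ring_nf
  rw [h]
  nlinarith [Real.add_one_le_exp (a - b), Real.exp_pos (-a)]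

theorem abs_one_sub_pow_sub_exp_le {n : ℕ} (hn : 1 ≤ n) {x : ℝ} (hx0 : 0 ≤ x) (hx1 : x ≤ 1) :
    |(1 - x) ^ n - Real.exp (-(n * x))| ≤ 2 / n := by
  have hn0 : (0 : ℝ) < n := by exact_mod_cast hn
  have hexp : Real.exp (-(n * x)) = Real.exp (-x) ^ n := by
    rw [← Real.exp_nat_mul]; ring_nf
  have hupper : (1 - x) ^ n ≤ Real.exp (-(n * x)) := by
    rw [hexp]
    exact pow_le_pow_left₀ (by linarith) (Real.one_sub_le_exp_neg x) n
  have hstep : Real.exp (-x) * (1 - x ^ 2) ≤ 1 - x := by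
    have h1 : Real.exp (-x) * (1 + x) ≤ 1 := by
      rw [Real.exp_neg, mul_comm, ← div_eq_mul_inv, div_le_one (Real.exp_pos x)]
      linarith [Real.add_one_le_exp x]
    nlinarith
  have hbern : 1 - n * x ^ 2 ≤ (1 - x ^ 2) ^ n := by
    have := one_add_mul_le_pow (a := -x ^ 2) (by nlinarith) n
    calc 1 - n * x ^ 2 = 1 + n * (-x ^ 2) := by ring
      _ ≤ (1 + -x ^ 2) ^ n := this
      _ = (1 - x ^ 2) ^ n := by ring
  have hlower : Real.exp (-(n * x)) * (1 - n * x ^ 2) ≤ (1 - x) ^ n := by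
    calc Real.exp (-(n * x)) * (1 - n * x ^ 2)
        ≤ Real.exp (-x) ^ n * (1 - x ^ 2) ^ n := by
          rw [hexp]; gcongr
      _ = (Real.exp (-x) * (1 - x ^ 2)) ^ n := (mul_pow _ _ _).symm
      _ ≤ (1 - x) ^ n :=
          pow_le_pow_left₀ (mul_nonneg (Real.exp_pos _).le (by nlinarith)) hstep n
  have hsq := sq_mul_exp_neg_le (y := n * x) (by positivity)
  rw [abs_le, le_div_iff₀ hn0, ← neg_div, div_le_iff₀ hn0]
  constructor
  · nlinarith
  · nlinarith

theorem one_sub_mul_pow_le {c : ℝ} (h0 : 0 ≤ c) (h1 : c ≤ 1) (n : ℕ) :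
    (1 - c) * c ^ n * n ≤ 1 := by
  have h : (1 - c) * c ^ n * n ≤ 1 - c ^ n := by
    induction n with
    | zero => simp
    | succ n ih =>
      have hp : 0 ≤ c ^ n := pow_nonneg h0 n
      have hc : c * ((1 - c) * c ^ n * n) ≤ c * (1 - c ^ n) := mul_le_mul_of_nonneg_left ih h0
      push_cast
      have hq : c ^ n * c ≤ 1 * c := mul_le_mul_of_nonneg_right (pow_le_one₀ h0 h1) h0
      have hr : (1 - c) * (c ^ n * c) ≤ (1 - c) * 1 :=
        mul_le_mul_of_nonneg_left (by linarith) (by linarith)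
      rw [pow_succ]
      nlinarith
  linarith [pow_nonneg h0 n]

theorem abs_charFun_pow_sub_exp_le {n : ℕ} (hn : 1 ≤ n) {r : ℝ} (hr0 : 0 < r) (hr1 : r ≤ 1)
    {c : ℝ} (hc0 : -1 ≤ c) (hc1 : c ≤ 1) :
    |(1 - r * (1 - c)) ^ n * (1 + c) - 2 * Real.exp (-(n * r * (1 - c)))| ≤ 5 / (n * r) := by
  have hn0 : (0 : ℝ) < n := by exact_mod_cast hn
  have hN : 0 < n * r := by positivity
  have hle : 1 / (n : ℝ) ≤ 1 / (n * r) := one_div_le_one_div_of_le hN (by nlinarith)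
  have hx0 : 0 ≤ r * (1 - c) := mul_nonneg hr0.le (by linarith)
  have hassoc : (n : ℝ) * r * (1 - c) = n * (r * (1 - c)) := by ring
  rcases le_or_gt (r * (1 - c)) 1 with hx1 | hx1
  · have h1 := abs_one_sub_pow_sub_exp_le hn hx0 hx1
    rw [← hassoc] at h1
    have h2 : (1 - c) * Real.exp (-(n * r * (1 - c))) ≤ 1 / (n * r) := by
      rw [le_div_iff₀ hN]
      linarith [mul_exp_neg_le_one (n * r * (1 - c))]
    have h3 : 0 ≤ (1 - c) * Real.exp (-(n * r * (1 - c))) :=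
      mul_nonneg (by linarith) (Real.exp_pos _).le
    calc |(1 - r * (1 - c)) ^ n * (1 + c) - 2 * Real.exp (-(n * r * (1 - c)))|
        = |((1 - r * (1 - c)) ^ n - Real.exp (-(n * r * (1 - c)))) * (1 + c)
            - (1 - c) * Real.exp (-(n * r * (1 - c)))| := by ring_nf
      _ ≤ |((1 - r * (1 - c)) ^ n - Real.exp (-(n * r * (1 - c)))) * (1 + c)|
            + |(1 - c) * Real.exp (-(n * r * (1 - c)))| := abs_sub _ _
      _ ≤ 2 / n * 2 + 1 / (n * r) := by
          rw [abs_mul, abs_of_nonneg h3, abs_of_nonneg (by linarith : 0 ≤ 1 + c)]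
          gcongr <;> linarith
      _ = 4 * (1 / n) + 1 / (n * r) := by ring
      _ ≤ 4 * (1 / (n * r)) + 1 / (n * r) := by gcongr
      _ = 5 / (n * r) := by ring
  · have hneg : 0 ≤ -c := by nlinarith
    have h1 : |(1 - r * (1 - c)) ^ n * (1 + c)| ≤ 1 / n := by
      rw [abs_mul, abs_pow, abs_of_nonneg (by linarith : 0 ≤ 1 + c), le_div_iff₀ hn0]
      have habs : |1 - r * (1 - c)| ≤ -c := by
        rw [abs_le]; constructor <;> nlinarith
      calc |1 - r * (1 - c)| ^ n * (1 + c) * n ≤ (-c) ^ n * (1 + c) * n := by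
            have : 0 ≤ 1 + c := by linarith
            gcongr
        _ = (1 - -c) * (-c) ^ n * n := by ring
        _ ≤ 1 := one_sub_mul_pow_le hneg (by linarith) n
    have h2 : Real.exp (-(n * r * (1 - c))) ≤ 1 / n := by
      rw [le_div_iff₀ hn0, hassoc]
      have := mul_exp_neg_le_one (n * (r * (1 - c)))
      have he := Real.exp_pos (-(n * (r * (1 - c))))
      have : (n : ℝ) ≤ n * (r * (1 - c)) := by nlinarith
      nlinarith
    calc |(1 - r * (1 - c)) ^ n * (1 + c) - 2 * Real.exp (-(n * r * (1 - c)))|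
        ≤ |(1 - r * (1 - c)) ^ n * (1 + c)| + |2 * Real.exp (-(n * r * (1 - c)))| := abs_sub _ _
      _ ≤ 1 / n + 2 * (1 / n) := by
          rw [abs_of_nonneg (by positivity : 0 ≤ 2 * Real.exp (-(n * r * (1 - c))))]
          gcongr
      _ = 3 * (1 / n) := by ring
      _ ≤ 5 * (1 / (n * r)) := by
          have : 0 < 1 / (n * r) := by positivity
          linarith
      _ = 5 / (n * r) := by ring

theorem sq_div_two_sub_one_sub_cos_le (θ : ℝ) : θ ^ 2 / 2 - (1 - Real.cos θ) ≤ θ ^ 4 / 2 := by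
  rcases le_or_gt |θ| 1 with h | h
  · have h1 := (abs_le.1 (Real.cos_bound h)).2
    have h2 : |θ| ^ 4 = θ ^ 4 := by rw [← abs_pow, abs_of_nonneg (by positivity)]
    rw [h2] at h1
    nlinarith [pow_nonneg (sq_nonneg θ) 2]
  · have h1 : 1 ≤ θ ^ 2 := by nlinarith [sq_abs θ]
    nlinarith [Real.cos_le_one θ]

theorem abs_exp_cos_sub_exp_sq_le {N : ℝ} (hN : 0 < N) {θ : ℝ} (hθ : |θ| ≤ Real.pi) :
    |Real.exp (-(N * (1 - Real.cos θ))) - Real.exp (-(N / 2 * θ ^ 2))| ≤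
      Real.pi ^ 4 / 4 / N := by
  have hpi := Real.pi_pos
  have hcos := Real.one_sub_sq_div_two_le_cos (x := θ)
  have hquad := Real.cos_le_one_sub_mul_cos_sq hθ
  have hmono : Real.exp (-(N / 2 * θ ^ 2)) ≤ Real.exp (-(N * (1 - Real.cos θ))) := by
    apply Real.exp_le_exp.2
    nlinarith
  rw [abs_of_nonneg (by linarith), le_div_iff₀ hN]
  set y := 2 / Real.pi ^ 2 * θ ^ 2 * N with hy
  have hy2 : y ^ 2 * Real.exp (-y) ≤ 2 := sq_mul_exp_neg_le (by positivity)
  have hexp : Real.exp (-(N * (1 - Real.cos θ))) ≤ Real.exp (-y) := by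
    apply Real.exp_le_exp.2
    nlinarith
  have hd : 0 ≤ N * (θ ^ 4 / 2) := by positivity
  calc (Real.exp (-(N * (1 - Real.cos θ))) - Real.exp (-(N / 2 * θ ^ 2))) * N
      ≤ ((N / 2 * θ ^ 2 - N * (1 - Real.cos θ)) * Real.exp (-(N * (1 - Real.cos θ)))) * N := by
        gcongr
        exact exp_neg_sub_exp_neg_le _ _
    _ ≤ (N * (θ ^ 4 / 2) * Real.exp (-y)) * N := by
        have := sq_div_two_sub_one_sub_cos_le θ
        gcongr
        nlinarith
    _ = Real.pi ^ 4 / 8 * (y ^ 2 * Real.exp (-y)) := by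
        rw [hy]; field_simp; ring
    _ ≤ Real.pi ^ 4 / 8 * 2 := by gcongr
    _ = Real.pi ^ 4 / 4 := by ring

theorem gaussian_tail_le {b : ℝ} (hb : 0 < b) :
    ∫ θ in Set.Ioi Real.pi, Real.exp (-b * θ ^ 2) ≤ 1 / b := by
  have hpi := Real.pi_pos
  have h_int : MeasureTheory.IntegrableOn (fun θ : ℝ => b⁻¹ * θ ^ (-2 : ℝ)) (Set.Ioi Real.pi) :=
    (integrableOn_Ioi_rpow_of_lt (by norm_num) hpi).const_mul _
  calc ∫ θ in Set.Ioi Real.pi, Real.exp (-b * θ ^ 2)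
      ≤ ∫ θ in Set.Ioi Real.pi, b⁻¹ * θ ^ (-2 : ℝ) := by
        refine MeasureTheory.setIntegral_mono_on (integrable_exp_neg_mul_sq hb).integrableOn h_int
          measurableSet_Ioi fun θ hθ => ?_
        have hθ0 : 0 < θ := hpi.trans hθ
        have h := mul_exp_neg_le_one (b * θ ^ 2)
        rw [Real.rpow_neg hθ0.le, Real.rpow_two, ← mul_inv, ← one_div,
          le_div_iff₀ (by positivity), neg_mul]
        linarith
    _ = b⁻¹ * Real.pi⁻¹ := by
        rw [MeasureTheory.integral_const_mul, integral_Ioi_rpow_of_lt (by norm_num) hpi]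
        norm_num [Real.rpow_neg_one]
    _ ≤ b⁻¹ * 1 := by
        gcongr
        exact inv_le_one_of_one_le₀ (by linarith [Real.pi_gt_three])
    _ = 1 / b := by ring

theorem inv_sqrt_eq_gaussian_integral {N : ℝ} (hN : 0 < N) :
    (Real.sqrt (Real.pi / 2 * N))⁻¹ =
      Real.pi⁻¹ * (2 * ∫ θ in Set.Ioi (0 : ℝ), Real.exp (-(N / 2) * θ ^ 2)) := by
  have hpi := Real.pi_pos
  have hs : Real.sqrt (Real.pi / (N / 2)) = Real.pi / Real.sqrt (Real.pi / 2 * N) := by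
    rw [eq_div_iff (by positivity), ← Real.sqrt_mul (by positivity),
      show Real.pi / (N / 2) * (Real.pi / 2 * N) = Real.pi ^ 2 by field_simp,
      Real.sqrt_sq hpi.le]
  rw [integral_gaussian_Ioi, hs]
  field_simp

/-- There is a global constant `C > 0` such that for every `n ≥ 1` and `0 < r ≤ 1`,
with `η = (π/2)·n·r`, `|P(S_n^r ∈ {0,1}) - η^{-1/2}| ≤ C/η`. -/
theorem walk_pair_prob_asymptotics :
    ∃ C : ℝ, 0 < C ∧ ∀ (n : ℕ) (r : ℝ), 1 ≤ n → 0 < r → r ≤ 1 →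
      |walk r n 0 + walk r n 1 - (Real.sqrt (Real.pi / 2 * n * r))⁻¹|
        ≤ C / (Real.pi / 2 * n * r) := by
  have hpi := Real.pi_pos
  refine ⟨Real.pi / 2 * (5 + Real.pi ^ 4 / 2 + Real.pi⁻¹ * 4), by positivity,
    fun n r hn hr0 hr1 => ?_⟩
  have hn0 : (0 : ℝ) < n := by exact_mod_cast hn
  have hN : 0 < n * r := by positivity
  set f : ℝ → ℝ := fun θ => (1 - r * (1 - Real.cos θ)) ^ n * (1 + Real.cos θ) with hf
  set g : ℝ → ℝ := fun θ => Real.exp (-(n * r / 2) * θ ^ 2) with hg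
  have hfc : Continuous f := by fun_prop
  have hgc : Continuous g := by fun_prop
  have hgi : MeasureTheory.Integrable g := integrable_exp_neg_mul_sq (by positivity)
  have hwalk : walk r n 0 + walk r n 1 = Real.pi⁻¹ * ∫ θ in (0 : ℝ)..Real.pi, f θ := by
    rw [walk_eq_integral, walk_eq_integral, ← mul_add, ← intervalIntegral.integral_add
      ((by fun_prop : Continuous _).intervalIntegrable _ _)
      ((by fun_prop : Continuous _).intervalIntegrable _ _)]
    congr 2
    ext θ
    simp [hf]
    ring
  have hpoint : ∀ θ ∈ Set.uIoc 0 Real.pi,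
      ‖f θ - 2 * g θ‖ ≤ (5 + Real.pi ^ 4 / 2) / (n * r) := by
    intro θ hθ
    rw [Set.uIoc_of_le hpi.le] at hθ
    have h1 := abs_charFun_pow_sub_exp_le hn hr0 hr1 (Real.neg_one_le_cos θ) (Real.cos_le_one θ)
    have h2 := abs_exp_cos_sub_exp_sq_le hN (θ := θ) (by rw [abs_of_pos hθ.1]; exact hθ.2)
    rw [Real.norm_eq_abs]
    calc |f θ - 2 * g θ|
        = |(f θ - 2 * Real.exp (-(n * r * (1 - Real.cos θ)))) +
            2 * (Real.exp (-(n * r * (1 - Real.cos θ))) - Real.exp (-(n * r / 2 * θ ^ 2)))| := by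
          simp only [hg, neg_mul]; ring_nf
      _ ≤ 5 / (n * r) + 2 * (Real.pi ^ 4 / 4 / (n * r)) := by
          refine (abs_add_le _ _).trans (add_le_add h1 ?_)
          rw [abs_mul, abs_two]
          gcongr
      _ = (5 + Real.pi ^ 4 / 2) / (n * r) := by ring
  have hmain := intervalIntegral.norm_integral_le_of_norm_le_const hpoint
  rw [intervalIntegral.integral_sub (hfc.intervalIntegrable _ _)
    ((hgc.intervalIntegrable _ _).const_mul _), intervalIntegral.integral_const_mul,
    Real.norm_eq_abs, sub_zero, abs_of_pos hpi] at hmain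
  have htail : ∫ θ in Set.Ioi Real.pi, g θ ≤ 1 / (n * r / 2) := gaussian_tail_le (by positivity)
  have htail0 : 0 ≤ ∫ θ in Set.Ioi Real.pi, g θ :=
    MeasureTheory.integral_nonneg fun θ => (Real.exp_pos _).le
  have hsplit : (∫ θ in Set.Ioi (0 : ℝ), g θ) =
      (∫ θ in (0 : ℝ)..Real.pi, g θ) + ∫ θ in Set.Ioi Real.pi, g θ :=
    (intervalIntegral.integral_interval_add_Ioi hgi.integrableOn hgi.integrableOn).symm
  rw [hwalk, mul_assoc (Real.pi / 2), inv_sqrt_eq_gaussian_integral hN, ← mul_sub, abs_mul,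
    abs_of_pos (inv_pos.2 hpi), hsplit]
  calc Real.pi⁻¹ * |(∫ θ in (0 : ℝ)..Real.pi, f θ) -
          2 * ((∫ θ in (0 : ℝ)..Real.pi, g θ) + ∫ θ in Set.Ioi Real.pi, g θ)|
      ≤ Real.pi⁻¹ * ((5 + Real.pi ^ 4 / 2) / (n * r) * Real.pi + 2 * (1 / (n * r / 2))) := by
        gcongr
        rw [abs_le] at hmain ⊢
        constructor <;> linarith [hmain.1, hmain.2]
    _ = _ := by field_simp; ring
end
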